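/- arXiv:1406.7026 — 4 statements merged into one kernel-verified Lean document; each statement's English description precedes it below -/
import Mathlib

section
/- Let U ∈ ℝ^{M×N}, let Φ : ℝ^{M×N} → ℝ^{M×N}, let c > 0, 0 < q < 1, and let R ≥ 2 be an integer. Suppose there exists U₀ ∈ ℝ^{M×N} with rank(U₀) ≤ 1 such that the iterates U_{n+1} = Φ(U_n) satisfy ‖U_n − U‖_F ≤ c·q^n·‖U₀ − U‖_F for all n ≥ 0 (contraction) and rank(U_{n+1}) ≤ R·rank(U_n) for all n ≥ 0 (finite rank growth). Then for every integer r ≥ 1, writing n = ⌊log_R r⌋ and s = r − R^n, the best rank-r approximation error satisfies τ_r(U) ≤ c·‖U₀ − U‖_F · sqrt(1 − (1−q²)·s / ((R−1)·R^n)) · q^n. -/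
/-- Frobenius inner product of real matrices. -/
noncomputable def frobInner {M N : ℕ} (X Y : Matrix (Fin M) (Fin N) ℝ) : ℝ :=
  ∑ i, ∑ j, X i j * Y i j

/-- Frobenius norm of a real matrix. -/
noncomputable def frobNorm {M N : ℕ} (X : Matrix (Fin M) (Fin N) ℝ) : ℝ :=
  Real.sqrt (frobInner X X)

/-- Best rank-`r` approximation error in the Frobenius norm. -/
noncomputable def tau {M N : ℕ} (r : ℕ) (U : Matrix (Fin M) (Fin N) ℝ) : ℝ :=
  sInf {x : ℝ | ∃ V : Matrix (Fin M) (Fin N) ℝ, V.rank ≤ r ∧ x = frobNorm (U - V)}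

open Matrix

theorem frobInner_self_eq_trace {M N : ℕ} (X : Matrix (Fin M) (Fin N) ℝ) :
    frobInner X X = (Xᵀ * X).trace := by
  simp only [frobInner, Matrix.trace, Matrix.diag, Matrix.mul_apply, Matrix.transpose_apply]
  exact Finset.sum_comm

theorem frobInner_self_nonneg {M N : ℕ} (X : Matrix (Fin M) (Fin N) ℝ) :
    0 ≤ frobInner X X :=
  Finset.sum_nonneg fun _ _ => Finset.sum_nonneg fun _ _ => mul_self_nonneg _

theorem frobInner_self_mul_orthogonal {M N : ℕ} (X : Matrix (Fin M) (Fin N) ℝ)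
    {O : Matrix (Fin N) (Fin N) ℝ} (hO : O * Oᵀ = 1) :
    frobInner (X * O) (X * O) = frobInner X X := by
  rw [frobInner_self_eq_trace, frobInner_self_eq_trace, Matrix.transpose_mul,
    Matrix.trace_mul_comm, Matrix.mul_assoc, ← Matrix.mul_assoc O, hO, Matrix.one_mul,
    Matrix.trace_mul_comm]

/-- Every real matrix can be rotated on the right so that its columns become orthogonal. -/
theorem exists_orthogonal_transpose_mul_self_eq_diagonal {M N : ℕ}
    (U : Matrix (Fin M) (Fin N) ℝ) :
    ∃ (O : Matrix (Fin N) (Fin N) ℝ) (l : Fin N → ℝ), O * Oᵀ = 1 ∧ Oᵀ * O = 1 ∧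
      (∀ i, 0 ≤ l i) ∧ (U * O)ᵀ * (U * O) = Matrix.diagonal l := by
  have hpos : (Uᵀ * U).PosSemidef := by
    simpa [Matrix.conjTranspose_eq_transpose_of_trivial] using
      Matrix.posSemidef_conjTranspose_mul_self U
  have hH := hpos.isHermitian
  let O : Matrix (Fin N) (Fin N) ℝ := hH.eigenvectorUnitary
  have h1 : O * Oᵀ = 1 := by
    simpa [Matrix.star_eq_conjTranspose, Matrix.conjTranspose_eq_transpose_of_trivial] using
      (Matrix.mem_unitaryGroup_iff.1 hH.eigenvectorUnitary.2)
  have h2 : Oᵀ * O = 1 := mul_eq_one_comm.1 h1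
  have hs : Uᵀ * U = O * Matrix.diagonal hH.eigenvalues * Oᵀ := by
    have h := hH.spectral_theorem
    simpa [Unitary.conjStarAlgAut_apply, Matrix.star_eq_conjTranspose,
      Matrix.conjTranspose_eq_transpose_of_trivial] using h
  refine ⟨O, hH.eigenvalues, h1, h2, hpos.eigenvalues_nonneg, ?_⟩
  calc (U * O)ᵀ * (U * O) = Oᵀ * (Uᵀ * U) * O := by
        simp only [Matrix.transpose_mul, Matrix.mul_assoc]
    _ = Oᵀ * (O * Matrix.diagonal hH.eigenvalues * Oᵀ) * O :=
        congrArg (fun A => Oᵀ * A * O) hs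
    _ = (Oᵀ * O) * Matrix.diagonal hH.eigenvalues * (Oᵀ * O) := by
        simp only [Matrix.mul_assoc]
    _ = _ := by rw [h2, Matrix.one_mul, Matrix.mul_one]

/-- A matrix of small rank captures at most `rank W` units of weight of the squared column norms
of a matrix with orthogonal columns. -/
theorem exists_weights_le_frobInner_sub {M N : ℕ} {G : Matrix (Fin M) (Fin N) ℝ}
    {l : Fin N → ℝ} (hG : Gᵀ * G = Matrix.diagonal l) (W : Matrix (Fin M) (Fin N) ℝ) :
    ∃ p : Fin N → ℝ, (∀ i, 0 ≤ p i) ∧ (∀ i, p i ≤ 1) ∧ ∑ i, p i ≤ W.rank ∧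
      ∑ i, (1 - p i) * l i ≤ frobInner (W - G) (W - G) := by
  let K : Submodule ℝ (EuclideanSpace ℝ (Fin N)) := LinearMap.ker (Matrix.toEuclideanLin W)
  let w := stdOrthonormalBasis ℝ K
  let v : Fin (Module.finrank ℝ K) → EuclideanSpace ℝ (Fin N) := fun k => (w k : _)
  have hv : Orthonormal ℝ v := w.orthonormal.comp_linearIsometry K.subtypeₗᵢ
  have hWv : ∀ k, W *ᵥ (v k).ofLp = 0 := fun k => by
    have h : Matrix.toEuclideanLin W (v k) = 0 := (w k).2
    simpa using congrArg WithLp.ofLp h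
  have hinner : ∀ k (x : EuclideanSpace ℝ (Fin N)), inner ℝ (v k) x = ∑ i, x i * v k i :=
    fun k x => by simp [PiLp.inner_apply]
  have hnorm : ∀ k, ∑ i, v k i ^ 2 = 1 := fun k => by
    rw [← EuclideanSpace.real_norm_sq_eq, hv.1 k, one_pow]
  have hdim : W.rank + Module.finrank ℝ K = N := by
    have h := LinearMap.finrank_range_add_finrank_ker (Matrix.toEuclideanLin W)
    rw [finrank_euclideanSpace_fin] at h
    have hW : W.rank = Module.finrank ℝ (LinearMap.range (Matrix.toEuclideanLin W)) := by
      rw [Matrix.rank_eq_finrank_range_toLin W (EuclideanSpace.basisFun _ ℝ).toBasis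
        (EuclideanSpace.basisFun _ ℝ).toBasis, Matrix.toEuclideanLin_eq_toLin_orthonormal]
    rw [hW]
    exact h
  refine ⟨fun i => 1 - ∑ k, v k i ^ 2, fun i => ?_, fun i => ?_, ?_, ?_⟩
  · have h := hv.sum_inner_products_le (EuclideanSpace.single i (1 : ℝ)) (s := Finset.univ)
    simp [hinner] at h
    linarith
  · have : 0 ≤ ∑ k, v k i ^ 2 := Finset.sum_nonneg fun _ _ => sq_nonneg _
    linarith
  · rw [Finset.sum_sub_distrib, Finset.sum_comm]
    simp only [hnorm]
    have h : (W.rank : ℝ) + Module.finrank ℝ K = N := by exact_mod_cast hdim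
    simp
    linarith
  · have hquad : ∀ k, ∑ a, ((W - G) *ᵥ (v k).ofLp) a ^ 2 = ∑ i, v k i ^ 2 * l i := fun k => by
      calc _ = (G *ᵥ (v k).ofLp) ⬝ᵥ (G *ᵥ (v k).ofLp) := by
            simp [Matrix.sub_mulVec, hWv, dotProduct, sq]
        _ = (v k).ofLp ⬝ᵥ ((Gᵀ * G) *ᵥ (v k).ofLp) := by
            rw [← Matrix.mulVec_mulVec, Matrix.dotProduct_mulVec _ Gᵀ, Matrix.vecMul_transpose]
        _ = _ := by
            rw [hG]
            simp only [dotProduct, Matrix.mulVec_diagonal]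
            exact Finset.sum_congr rfl fun i _ => by ring
    calc ∑ i, (1 - (1 - ∑ k, v k i ^ 2)) * l i = ∑ k, ∑ i, v k i ^ 2 * l i := by
          rw [Finset.sum_comm]
          exact Finset.sum_congr rfl fun i _ => by rw [← Finset.sum_mul]; ring
      _ = ∑ a, ∑ k, ((W - G) *ᵥ (v k).ofLp) a ^ 2 := by
          simp only [← hquad]
          exact Finset.sum_comm
      _ ≤ _ := Finset.sum_le_sum fun a _ => by
          have h := hv.sum_inner_products_le (WithLp.toLp 2 ((W - G) a)) (s := Finset.univ)
          rw [EuclideanSpace.real_norm_sq_eq] at h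
          simpa only [hinner, Real.norm_eq_abs, sq_abs, Matrix.mulVec, dotProduct, ← sq] using h

/-- A fractional selection of total weight at most `r` is dominated by a selection of at most `r`
elements. -/
theorem exists_finset_card_le_sum_mul_le {ι : Type*} [Fintype ι] (l p : ι → ℝ) (r : ℕ)
    (hl : ∀ i, 0 ≤ l i) (hp0 : ∀ i, 0 ≤ p i) (hp1 : ∀ i, p i ≤ 1) (hp : ∑ i, p i ≤ r) :
    ∃ S : Finset ι, S.card ≤ r ∧ ∑ i, p i * l i ≤ ∑ i ∈ S, l i := by
  classical
  rcases le_or_gt (Fintype.card ι) r with hr | hr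
  · exact ⟨Finset.univ, hr, Finset.sum_le_sum fun i _ =>
      mul_le_of_le_one_left (hl i) (hp1 i)⟩
  have hne : (Finset.powersetCard r (Finset.univ : Finset ι)).Nonempty :=
    Finset.powersetCard_nonempty.2 hr.le
  obtain ⟨S, hS, hmax⟩ := Finset.exists_max_image _ (fun S => ∑ i ∈ S, l i) hne
  have hcard : S.card = r := (Finset.mem_powersetCard.1 hS).2
  have hex : ∀ i ∈ S, ∀ j ∉ S, l j ≤ l i := fun i hi j hj => by
    have hj' : j ∉ S.erase i := fun h => hj (Finset.mem_of_mem_erase h)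
    have h := hmax (insert j (S.erase i)) (Finset.mem_powersetCard.2 ⟨Finset.subset_univ _, by
      rw [Finset.card_insert_of_notMem hj', Finset.card_erase_add_one hi, hcard]⟩)
    rw [Finset.sum_insert hj', ← Finset.add_sum_erase S l hi] at h
    linarith
  obtain ⟨m, hm, hmm⟩ := Finset.exists_max_image Sᶜ l (Finset.card_pos.1 (by
    rw [Finset.card_compl]; omega))
  refine ⟨S, hcard.le, ?_⟩
  have key : ∀ i, p i * l i ≤ (if i ∈ S then l i else 0) +
      l m * (p i - if i ∈ S then 1 else 0) := fun i => by
    by_cases hi : i ∈ S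
    · have := hex i hi m (Finset.mem_compl.1 hm)
      simp only [hi, if_true]
      nlinarith [hp1 i]
    · have := hmm i (Finset.mem_compl.2 hi)
      simp only [hi, if_false]
      nlinarith [hp0 i]
  have h := Finset.sum_le_sum fun i (_ : i ∈ Finset.univ) => key i
  rw [Finset.sum_add_distrib, ← Finset.mul_sum, Finset.sum_sub_distrib] at h
  simp only [Finset.sum_ite_mem, Finset.univ_inter, Finset.sum_const, hcard, nsmul_eq_mul,
    mul_one] at h
  nlinarith [hl m]

/-- Convexity of the squared best approximation error as a function of the rank. -/
theorem exists_rank_le_frobInner_sub_le {M N : ℕ} (U V W : Matrix (Fin M) (Fin N) ℝ)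
    {t : ℝ} (ht0 : 0 ≤ t) (ht1 : t ≤ 1) (r : ℕ)
    (hr : (1 - t) * V.rank + t * W.rank ≤ r) :
    ∃ X : Matrix (Fin M) (Fin N) ℝ, X.rank ≤ r ∧ frobInner (U - X) (U - X) ≤
      (1 - t) * frobInner (V - U) (V - U) + t * frobInner (W - U) (W - U) := by
  obtain ⟨O, l, hO, hO', hl, hG⟩ := exists_orthogonal_transpose_mul_self_eq_diagonal U
  have hdiff : ∀ V : Matrix (Fin M) (Fin N) ℝ, ∃ p : Fin N → ℝ, (∀ i, 0 ≤ p i) ∧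
      (∀ i, p i ≤ 1) ∧ ∑ i, p i ≤ V.rank ∧
      ∑ i, (1 - p i) * l i ≤ frobInner (V - U) (V - U) := fun V => by
    obtain ⟨p, h0, h1, h2, h3⟩ := exists_weights_le_frobInner_sub hG (V * O)
    refine ⟨p, h0, h1, h2.trans (by exact_mod_cast Matrix.rank_mul_le_left V O), ?_⟩
    rwa [← Matrix.sub_mul, frobInner_self_mul_orthogonal _ hO] at h3
  obtain ⟨p, p0, p1, p2, p3⟩ := hdiff V
  obtain ⟨s, s0, s1, s2, s3⟩ := hdiff W
  have ht1' : 0 ≤ 1 - t := by linarith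
  obtain ⟨S, hS, hSl⟩ := exists_finset_card_le_sum_mul_le l
    (fun i => (1 - t) * p i + t * s i) r hl
    (fun i => add_nonneg (mul_nonneg ht1' (p0 i)) (mul_nonneg ht0 (s0 i)))
    (fun i => by nlinarith [p1 i, s1 i])
    (by
      rw [Finset.sum_add_distrib, ← Finset.mul_sum, ← Finset.mul_sum]
      nlinarith)
  let d : Fin N → ℝ := fun i => if i ∈ S then 1 else 0
  refine ⟨U * O * Matrix.diagonal d * Oᵀ, ?_, ?_⟩
  · refine (Matrix.rank_mul_le_left _ _).trans ((Matrix.rank_mul_le_right _ _).trans ?_)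
    rw [Matrix.rank_diagonal]
    refine le_trans (le_of_eq ?_) hS
    rw [Fintype.card_subtype]
    congr 1
    ext i
    simp [d]
  · have hrot : (U - U * O * Matrix.diagonal d * Oᵀ) * O =
        U * O * Matrix.diagonal (fun i => 1 - d i) := by
      rw [Matrix.sub_mul, Matrix.mul_assoc _ Oᵀ, hO', Matrix.mul_one,
        ← Matrix.diagonal_sub, Matrix.mul_sub, Matrix.diagonal_one, Matrix.mul_one]
    have herr : frobInner (U - U * O * Matrix.diagonal d * Oᵀ)
        (U - U * O * Matrix.diagonal d * Oᵀ) = ∑ i, l i - ∑ i ∈ S, l i := by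
      rw [← frobInner_self_mul_orthogonal _ hO, hrot, frobInner_self_eq_trace,
        Matrix.transpose_mul, Matrix.mul_assoc, ← Matrix.mul_assoc (U * O)ᵀ, hG,
        Matrix.diagonal_transpose, Matrix.diagonal_mul_diagonal, Matrix.diagonal_mul_diagonal,
        Matrix.trace_diagonal, ← Finset.sum_filter_add_sum_filter_not Finset.univ (· ∈ S) l,
        Finset.sum_filter, Finset.sum_filter, Finset.sum_ite_mem, Finset.univ_inter,
        add_sub_cancel_left]
      exact Finset.sum_congr rfl fun i _ => by by_cases hi : i ∈ S <;> simp [d, hi]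
    rw [herr]
    have e1 : ∑ i, ((1 - t) * p i + t * s i) * l i =
        ∑ i, l i - ((1 - t) * ∑ i, (1 - p i) * l i + t * ∑ i, (1 - s i) * l i) := by
      rw [Finset.mul_sum, Finset.mul_sum, ← Finset.sum_add_distrib, ← Finset.sum_sub_distrib]
      exact Finset.sum_congr rfl fun i _ => by ring
    nlinarith [mul_le_mul_of_nonneg_left p3 ht1', mul_le_mul_of_nonneg_left s3 ht0]

theorem tau_le_frobNorm_sub {M N r : ℕ} (U : Matrix (Fin M) (Fin N) ℝ)
    {X : Matrix (Fin M) (Fin N) ℝ} (hX : X.rank ≤ r) : tau r U ≤ frobNorm (U - X) :=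
  csInf_le ⟨0, by rintro _ ⟨V, -, rfl⟩; exact Real.sqrt_nonneg _⟩ ⟨X, hX, rfl⟩

/-- low-rank approximation error from a contractive fixed-point
iteration with finite rank growth, full (non-simplified) bound. -/
theorem tau_bound_of_fixed_point_iteration
    {M N : ℕ} (U : Matrix (Fin M) (Fin N) ℝ)
    (Φ : Matrix (Fin M) (Fin N) ℝ → Matrix (Fin M) (Fin N) ℝ)
    (c q : ℝ) (hc : 0 < c) (hq0 : 0 < q) (hq1 : q < 1)
    (R : ℕ) (hR : 2 ≤ R)
    (U₀ : Matrix (Fin M) (Fin N) ℝ) (hrank₀ : U₀.rank ≤ 1)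
    (u : ℕ → Matrix (Fin M) (Fin N) ℝ)
    (hu0 : u 0 = U₀)
    (hiter : ∀ n : ℕ, u (n + 1) = Φ (u n))
    (hcontr : ∀ n : ℕ, frobNorm (u n - U) ≤ c * q ^ n * frobNorm (U₀ - U))
    (hgrowth : ∀ n : ℕ, (u (n + 1)).rank ≤ R * (u n).rank)
    (r : ℕ) (hr : 1 ≤ r) :
    tau r U ≤ c * frobNorm (U₀ - U) *
        Real.sqrt (1 - (1 - q ^ 2) * ((r - R ^ Nat.log R r : ℕ) : ℝ) /
          (((R : ℝ) - 1) * (R : ℝ) ^ Nat.log R r)) *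
        q ^ Nat.log R r := by
  set n := Nat.log R r with hn
  have hrank : ∀ k, (u k).rank ≤ R ^ k := fun k => by
    induction k with
    | zero => simpa [hu0] using hrank₀
    | succ k ih =>
      exact (hgrowth k).trans (by rw [pow_succ']; exact Nat.mul_le_mul_left R ih)
  have hlow : R ^ n ≤ r := Nat.pow_log_le_self R (by omega)
  have hup : r < R ^ (n + 1) := Nat.lt_pow_succ_log_self (by omega) r
  have hR2 : (2 : ℝ) ≤ R := by exact_mod_cast hR
  have hpow : (0 : ℝ) < (R : ℝ) ^ n := by positivity
  have hden : 0 < ((R : ℝ) - 1) * (R : ℝ) ^ n := mul_pos (by linarith) hpow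
  have hs : ((r - R ^ n : ℕ) : ℝ) = r - (R : ℝ) ^ n := by push_cast [Nat.cast_sub hlow]; rfl
  have hlow' : (R : ℝ) ^ n ≤ r := by exact_mod_cast hlow
  have hup' : (r : ℝ) ≤ (R : ℝ) ^ n * R := by rw [← pow_succ]; exact_mod_cast hup.le
  rw [hs, mul_div_assoc]
  set t : ℝ := (r - (R : ℝ) ^ n) / (((R : ℝ) - 1) * (R : ℝ) ^ n) with ht
  have ht0 : 0 ≤ t := div_nonneg (by linarith) hden.le
  have ht1 : t ≤ 1 := (div_le_one hden).2 (by linarith)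
  have htr : t * (((R : ℝ) - 1) * (R : ℝ) ^ n) = r - (R : ℝ) ^ n := div_mul_cancel₀ _ hden.ne'
  have hA : ((u n).rank : ℝ) ≤ (R : ℝ) ^ n := by exact_mod_cast hrank n
  have hB : ((u (n + 1)).rank : ℝ) ≤ (R : ℝ) ^ n * R := by
    rw [← pow_succ]; exact_mod_cast hrank (n + 1)
  have ht1' : 0 ≤ 1 - t := by linarith
  obtain ⟨X, hX, hle⟩ := exists_rank_le_frobInner_sub_le U (u n) (u (n + 1)) ht0 ht1 r (by
    nlinarith [mul_le_mul_of_nonneg_left hA ht1', mul_le_mul_of_nonneg_left hB ht0])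
  refine (tau_le_frobNorm_sub U hX).trans ?_
  set E := frobNorm (U₀ - U)
  have hE : 0 ≤ E := Real.sqrt_nonneg _
  have hsq : ∀ k, frobInner (u k - U) (u k - U) ≤ (c * q ^ k * E) ^ 2 := fun k => by
    rw [← Real.sq_sqrt (frobInner_self_nonneg (u k - U))]
    exact pow_le_pow_left₀ (Real.sqrt_nonneg _) (hcontr k) 2
  have hnn : 0 ≤ 1 - (1 - q ^ 2) * t := by nlinarith [mul_nonneg ht0 (sq_nonneg q)]
  refine Real.sqrt_le_iff.2 ⟨by positivity, hle.trans ?_⟩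
  calc _ ≤ (1 - t) * (c * q ^ n * E) ^ 2 + t * (c * q ^ (n + 1) * E) ^ 2 :=
        add_le_add (mul_le_mul_of_nonneg_left (hsq n) ht1')
          (mul_le_mul_of_nonneg_left (hsq (n + 1)) ht0)
    _ = (c * E) ^ 2 * (1 - (1 - q ^ 2) * t) * (q ^ n) ^ 2 := by ring
    _ = _ := by
        rw [mul_pow _ (q ^ n), mul_pow (c * E) (Real.sqrt _), Real.sq_sqrt hnn]
end

section
/- Let L_1 ∈ ℝ^{M×M}, L_2 ∈ ℝ^{N×N}, α ∈ ℝ, B ∈ ℝ^{M×N}, and define the iteration U_{n+1} = U_n − α·(L_1 U_n + U_n L_2ᵀ − B) from a starting matrix U_0 ∈ ℝ^{M×N}. Then for every n ≥ 0: rank(U_n) ≤ (n+1)·rank(U_0) + n·rank(B). -/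
open Matrix

theorem Matrix.rank_add_le_rank_add_rank {m n K : Type*} [Finite m] [Fintype n] [Field K]
    (A B : Matrix m n K) : (A + B).rank ≤ A.rank + B.rank := by
  have hle : LinearMap.range (A + B).mulVecLin ≤
      LinearMap.range A.mulVecLin ⊔ LinearMap.range B.mulVecLin := by
    rintro _ ⟨v, rfl⟩
    rw [Matrix.mulVecLin_add, LinearMap.add_apply]
    exact Submodule.add_mem_sup ⟨v, rfl⟩ ⟨v, rfl⟩
  exact (Submodule.finrank_mono hle).trans (Submodule.finrank_add_le_finrank_add_finrank _ _)

theorem Matrix.rank_sum_mul_mul_le {m n K : Type*} [Fintype m] [Fintype n] [Field K]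
    (A : ℕ → Matrix m m K) (X : Matrix m n K) (P : ℕ → Matrix n n K) (k : ℕ) :
    (∑ i ∈ Finset.range k, A i * X * P i).rank ≤ k * X.rank := by
  induction k with
  | zero => simp
  | succ k ih =>
    rw [Finset.sum_range_succ, add_mul, one_mul]
    refine (Matrix.rank_add_le_rank_add_rank _ _).trans (add_le_add ih ?_)
    exact (Matrix.rank_mul_le_left _ _).trans (Matrix.rank_mul_le_right _ _)

/-- A Richardson step for a Sylvester operator, with source term `c • X`, raises by at most one
the number of powers of the left factor needed to express the iterate in terms of `X`. -/
theorem exists_sum_pow_mul_mul_richardson_step {m n K : Type*} [Fintype m] [DecidableEq m]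
    [Fintype n] [DecidableEq n] [Field K]
    (L : Matrix m m K) (R : Matrix n n K) (α c : K) (X : Matrix m n K)
    (P : ℕ → Matrix n n K) (k : ℕ) :
    ∃ Q : ℕ → Matrix n n K,
      (∑ i ∈ Finset.range k, L ^ i * X * P i)
          - α • (L * (∑ i ∈ Finset.range k, L ^ i * X * P i)
            + (∑ i ∈ Finset.range k, L ^ i * X * P i) * R) + c • X
        = ∑ i ∈ Finset.range (k + 1), L ^ i * X * Q i := by
  let S : ℕ → Matrix n n K := fun i => if i < k then P i * (1 - α • R) else 0
  let T : ℕ → Matrix n n K := fun i => Nat.casesOn i (c • 1) fun j => -α • P j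
  have hS : ∑ i ∈ Finset.range (k + 1), L ^ i * X * S i
      = (∑ i ∈ Finset.range k, L ^ i * X * P i) * (1 - α • R) := by
    rw [Finset.sum_range_succ, Matrix.sum_mul]
    simp only [S, lt_irrefl, if_false, Matrix.mul_zero, add_zero]
    refine Finset.sum_congr rfl fun i hi => ?_
    rw [if_pos (Finset.mem_range.mp hi), Matrix.mul_assoc _ (P i)]
  have hT : ∑ i ∈ Finset.range (k + 1), L ^ i * X * T i
      = -α • (L * ∑ i ∈ Finset.range k, L ^ i * X * P i) + c • X := by
    rw [Finset.sum_range_succ', Matrix.mul_sum, Finset.smul_sum]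
    simp [T, pow_succ', Matrix.mul_assoc]
  refine ⟨fun i => S i + T i, ?_⟩
  simp only [Matrix.mul_add, Finset.sum_add_distrib]
  rw [hS, hT, Matrix.mul_sub, Matrix.mul_one, Matrix.mul_smul]
  module

/-- linear (rather than exponential) rank growth of the
Richardson iteration for a Sylvester-type operator, thanks to the
commutativity of left and right multiplication. -/
theorem rank_growth_sylvester_richardson
    {M N : ℕ}
    (L₁ : Matrix (Fin M) (Fin M) ℝ) (L₂ : Matrix (Fin N) (Fin N) ℝ)
    (α : ℝ) (B : Matrix (Fin M) (Fin N) ℝ)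
    (U : ℕ → Matrix (Fin M) (Fin N) ℝ)
    (hiter : ∀ n : ℕ, U (n + 1) = U n - α • (L₁ * U n + U n * L₂ᵀ - B)) :
    ∀ n : ℕ, (U n).rank ≤ (n + 1) * (U 0).rank + n * B.rank := by
  have hU : ∀ n : ℕ, ∃ P Q : ℕ → Matrix (Fin N) (Fin N) ℝ,
      U n = ∑ i ∈ Finset.range (n + 1), L₁ ^ i * U 0 * P i
        + ∑ i ∈ Finset.range n, L₁ ^ i * B * Q i := by
    intro n
    induction n with
    | zero => exact ⟨fun _ => 1, fun _ => 0, by simp⟩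
    | succ n ih =>
      obtain ⟨P, Q, h⟩ := ih
      obtain ⟨P', hP⟩ := exists_sum_pow_mul_mul_richardson_step L₁ L₂ᵀ α 0 (U 0) P (n + 1)
      obtain ⟨Q', hQ⟩ := exists_sum_pow_mul_mul_richardson_step L₁ L₂ᵀ α α B Q n
      refine ⟨P', Q', ?_⟩
      rw [hiter, ← hP, ← hQ, h, Matrix.mul_add, Matrix.add_mul]
      module
  intro n
  obtain ⟨P, Q, h⟩ := hU n
  rw [h]
  exact (Matrix.rank_add_le_rank_add_rank _ _).trans
    (add_le_add (Matrix.rank_sum_mul_mul_le _ _ _ _) (Matrix.rank_sum_mul_mul_le _ _ _ _))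
end

section
/- Let E be a real Hilbert space, A : E → E a bounded self-adjoint linear operator, u ∈ E with u ≠ 0 and A u = λ_1 u, and suppose λ_2‖v‖² ≤ ⟨v, A v⟩ ≤ Γ‖v‖² for all v ∈ E with ⟨v, u⟩ = 0, where λ_1 < λ_2 ≤ Γ. Set δ = λ_2 − λ_1, Δ = δ/(Γ − λ_1) and β = 2/(δ + Γ − λ_1). Then for every v ∈ E with ⟨v, u⟩ = 0, the vector w = v − β(A v − λ_1 v) satisfies ⟨w, u⟩ = 0 and ‖w‖ ≤ ((1−Δ)/(1+Δ))·‖v‖. Consequently, the iterates u_{n+1} = u_n − β(A u_n − λ_1 u_n) started from any u_0 with ⟨u_0 − u, u⟩ = 0 satisfy ‖u_n − u‖ ≤ ((1−Δ)/(1+Δ))^n · ‖u_0 − u‖ for all n ≥ 0. -/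
open scoped RealInnerProductSpace

/-- A symmetric operator leaving a subspace `K` invariant is bounded in norm on `K` by any bound on
its quadratic form on `K`. -/
theorem LinearMap.IsSymmetric.norm_apply_le_of_abs_inner_le
    {E : Type*} [NormedAddCommGroup E] [InnerProductSpace ℝ E] {T : E →ₗ[ℝ] E}
    (hT : T.IsSymmetric) {K : Submodule ℝ E} (hK : ∀ x ∈ K, T x ∈ K) {c : ℝ}
    (hc : ∀ x ∈ K, |⟪x, T x⟫| ≤ c * ‖x‖ ^ 2) {x : E} (hx : x ∈ K) :
    ‖T x‖ ≤ c * ‖x‖ := by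
  have polar : ∀ y ∈ K, ∀ z ∈ K, 2 * ⟪T y, z⟫ ≤ c * (‖y‖ ^ 2 + ‖z‖ ^ 2) := by
    intro y hy z hz
    have hadd := (abs_le.mp (hc _ (K.add_mem hy hz))).2
    have hsub := (abs_le.mp (hc _ (K.sub_mem hy hz))).1
    rw [norm_add_sq_real] at hadd
    rw [norm_sub_sq_real] at hsub
    simp only [map_add, map_sub, inner_add_left, inner_add_right, inner_sub_left,
      inner_sub_right] at hadd hsub
    have hzy : ⟪z, T y⟫ = ⟪T y, z⟫ := real_inner_comm _ _
    have hyz : ⟪y, T z⟫ = ⟪T y, z⟫ := (hT y z).symm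
    linarith
  rcases eq_or_ne x 0 with rfl | hx0
  · simp
  rcases eq_or_ne (T x) 0 with hTx | hTx
  · have hsq := (abs_nonneg _).trans (hc x hx)
    have hpos : 0 < ‖x‖ := norm_pos_iff.mpr hx0
    rw [hTx, norm_zero]
    exact nonneg_of_mul_nonneg_left (by linarith : 0 ≤ c * ‖x‖ * ‖x‖) hpos
  have ha : 0 < ‖x‖ := norm_pos_iff.mpr hx0
  have hb : 0 < ‖T x‖ := norm_pos_iff.mpr hTx
  have h := polar (‖T x‖ • x) (K.smul_mem _ hx) (‖x‖ • T x) (K.smul_mem _ (hK x hx))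
  rw [map_smul, real_inner_smul_left, real_inner_smul_right, real_inner_self_eq_norm_sq,
    norm_smul, norm_smul, norm_norm, norm_norm] at h
  refine le_of_mul_le_mul_right ?_ (by positivity : 0 < ‖x‖ * ‖T x‖ ^ 2)
  linarith

/-- contraction of the Richardson iteration for the singular
system `(A - λ₁ I) u = 0` on the invariant subspace orthogonal to the
eigenvector `u` of the simple smallest eigenvalue `λ₁`. -/
theorem richardson_contraction_eigenvector
    {E : Type*} [NormedAddCommGroup E] [InnerProductSpace ℝ E]
    (A : E →L[ℝ] E)
    (hself : ∀ v w : E, ⟪A v, w⟫ = ⟪v, A w⟫)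
    (u : E) (hu : u ≠ 0)
    (lam₁ lam₂ Γ : ℝ) (hAu : A u = lam₁ • u)
    (h12 : lam₁ < lam₂) (h2Γ : lam₂ ≤ Γ)
    (hlow : ∀ v : E, ⟪v, u⟫ = 0 → lam₂ * ‖v‖ ^ 2 ≤ ⟪v, A v⟫)
    (hup : ∀ v : E, ⟪v, u⟫ = 0 → ⟪v, A v⟫ ≤ Γ * ‖v‖ ^ 2) :
    (∀ v : E, ⟪v, u⟫ = 0 →
      ⟪v - (2 / ((lam₂ - lam₁) + Γ - lam₁)) • (A v - lam₁ • v), u⟫ = 0 ∧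
      ‖v - (2 / ((lam₂ - lam₁) + Γ - lam₁)) • (A v - lam₁ • v)‖ ≤
        ((1 - (lam₂ - lam₁) / (Γ - lam₁)) / (1 + (lam₂ - lam₁) / (Γ - lam₁))) * ‖v‖) ∧
    (∀ useq : ℕ → E, ⟪useq 0 - u, u⟫ = 0 →
      (∀ n : ℕ, useq (n + 1) =
        useq n - (2 / ((lam₂ - lam₁) + Γ - lam₁)) • (A (useq n) - lam₁ • useq n)) →
      ∀ n : ℕ, ‖useq n - u‖ ≤
        ((1 - (lam₂ - lam₁) / (Γ - lam₁)) / (1 + (lam₂ - lam₁) / (Γ - lam₁))) ^ n *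
          ‖useq 0 - u‖) := by
  have hgap : 0 < Γ - lam₁ := by linarith
  have hD : 0 < (lam₂ - lam₁) + Γ - lam₁ := by linarith
  have hrate : (1 - (lam₂ - lam₁) / (Γ - lam₁)) / (1 + (lam₂ - lam₁) / (Γ - lam₁)) =
      (Γ - lam₂) / ((lam₂ - lam₁) + Γ - lam₁) := by
    have hsum : 1 + (lam₂ - lam₁) / (Γ - lam₁) ≠ 0 :=
      (add_pos one_pos (div_pos (by linarith) hgap)).ne'
    rw [div_eq_div_iff hsum hD.ne']
    field_simp
    ring
  rw [hrate]
  set β := 2 / ((lam₂ - lam₁) + Γ - lam₁) with hβ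
  set c := (Γ - lam₂) / ((lam₂ - lam₁) + Γ - lam₁) with hcdef
  have hβpos : 0 < β := by positivity
  have hc : 0 ≤ c := div_nonneg (by linarith) hD.le
  have hβlow : 1 - β * (lam₂ - lam₁) = c := by
    rw [hβ, hcdef]
    field_simp
    ring
  have hβup : 1 - β * (Γ - lam₁) = -c := by
    rw [hβ, hcdef]
    field_simp
    ring
  let T : E →ₗ[ℝ] E := LinearMap.id - β • ((A : E →ₗ[ℝ] E) - lam₁ • LinearMap.id)
  have hTapply : ∀ v, T v = v - β • (A v - lam₁ • v) := fun v => rfl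
  have hTsymm : T.IsSymmetric := by
    intro v w
    simp only [hTapply, inner_sub_left, inner_sub_right, real_inner_smul_left,
      real_inner_smul_right, hself]
  have hTorth : ∀ v, ⟪v, u⟫ = 0 → ⟪T v, u⟫ = 0 := by
    intro v hv
    simp [hTapply, inner_sub_left, real_inner_smul_left, real_inner_smul_right, hself, hAu, hv]
  have hquad : ∀ v, ⟪v, u⟫ = 0 → |⟪v, T v⟫| ≤ c * ‖v‖ ^ 2 := by
    intro v hv
    have hl := mul_le_mul_of_nonneg_left (hlow v hv) hβpos.le
    have hr := mul_le_mul_of_nonneg_left (hup v hv) hβpos.le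
    rw [hTapply, inner_sub_right, real_inner_smul_right, inner_sub_right, real_inner_smul_right,
      real_inner_self_eq_norm_sq, abs_le]
    constructor
    · rw [← neg_mul, ← hβup]
      linarith
    · rw [← hβlow]
      linarith
  have hnorm : ∀ v, ⟪v, u⟫ = 0 → ‖T v‖ ≤ c * ‖v‖ := by
    intro v hv
    refine hTsymm.norm_apply_le_of_abs_inner_le (K := (ℝ ∙ u)ᗮ) ?_ ?_ ?_
    all_goals simpa only [Submodule.mem_orthogonal_singleton_iff_inner_left]
  refine ⟨fun v hv => ⟨hTorth v hv, hnorm v hv⟩, fun useq h0 hstep => ?_⟩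
  have herr : ∀ n, useq (n + 1) - u = T (useq n - u) := by
    intro n
    have hTu : T u = u := by simp [hTapply, hAu]
    rw [map_sub, hTu, hTapply, hstep]
  have horth : ∀ n, ⟪useq n - u, u⟫ = 0 := by
    intro n
    induction n with
    | zero => exact h0
    | succ n ih => rw [herr]; exact hTorth _ ih
  intro n
  induction n with
  | zero => simp
  | succ n ih =>
    calc ‖useq (n + 1) - u‖ ≤ c * ‖useq n - u‖ := by rw [herr]; exact hnorm _ (horth n)
      _ ≤ c * (c ^ n * ‖useq 0 - u‖) := by gcongr
      _ = c ^ (n + 1) * ‖useq 0 - u‖ := by ring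
end

section
/- Let A_1, B ∈ ℝ^{M×M}, A_2, C ∈ ℝ^{N×N}, and scalars c, β ∈ ℝ, and define the linear map M : ℝ^{M×N} → ℝ^{M×N} by M(U) = c·U − β·(A_1 U + U A_2ᵀ + B U Cᵀ). Then for every U ∈ ℝ^{M×N}: rank(M(M(U))) ≤ 6·rank(U); that is, two steps of this iteration increase the rank not by the factor 3² = 9 but only by at most 6. -/
open Matrix

lemma Matrix.rank_mul_mul_le {R l m n o : Type*} [Fintype m] [Fintype n] [Fintype o] [Field R]
    (X : Matrix l m R) (U : Matrix m n R) (Y : Matrix n o R) :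
    (X * U * Y).rank ≤ U.rank :=
  (rank_mul_le_left _ _).trans (rank_mul_le_right _ _)

lemma Matrix.rank_add_le_add {R m n : Type*} [Finite m] [Fintype n] [Field R]
    (X Y : Matrix m n R) :
    (X + Y).rank ≤ X.rank + Y.rank := by
  unfold Matrix.rank
  rw [Matrix.mulVecLin_add]
  calc
    _ ≤ Module.finrank R ↥(X.mulVecLin.range ⊔ Y.mulVecLin.range) :=
      Submodule.finrank_mono (LinearMap.range_add_le _ _)
    _ ≤ _ := Submodule.finrank_add_le_finrank_add_finrank _ _

/-- two steps of the (shifted) Richardson iteration for an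
operator of the form `U ↦ A₁ U + U A₂ᵀ + B U Cᵀ` increase the rank by at most
the factor 6 (rather than 3² = 9). -/
theorem two_step_rank_growth
    {M N : ℕ}
    (A₁ B : Matrix (Fin M) (Fin M) ℝ)
    (A₂ C : Matrix (Fin N) (Fin N) ℝ)
    (c β : ℝ)
    (Mop : Matrix (Fin M) (Fin N) ℝ → Matrix (Fin M) (Fin N) ℝ)
    (hMop : ∀ U, Mop U = c • U - β • (A₁ * U + U * A₂ᵀ + B * U * Cᵀ)) :
    ∀ U : Matrix (Fin M) (Fin N) ℝ, (Mop (Mop U)).rank ≤ 6 * U.rank := by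
  intro U
  obtain ⟨P, hP⟩ : ∃ P, P = c • (1 : Matrix (Fin M) (Fin M) ℝ) - β • A₁ := ⟨_, rfl⟩
  obtain ⟨Q, hQ⟩ : ∃ Q, Q = -(β • A₂ᵀ) := ⟨_, rfl⟩
  obtain ⟨S, hS⟩ : ∃ S, S = -(β • B) := ⟨_, rfl⟩
  have hstep : ∀ V, Mop V = P * V + V * Q + S * V * Cᵀ := by
    intro V
    rw [hMop, hP, hQ, hS]
    simp only [Matrix.sub_mul, Matrix.smul_mul, Matrix.one_mul, Matrix.mul_neg, Matrix.neg_mul,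
      Matrix.mul_smul, smul_add]
    abel
  have hexpand : Mop (Mop U) = P * P * U * (1 : Matrix (Fin N) (Fin N) ℝ)
      + (P + P) * U * Q + (1 : Matrix (Fin M) (Fin M) ℝ) * U * (Q * Q)
      + (P * S + S * P) * U * Cᵀ + S * U * (Q * Cᵀ + Cᵀ * Q) + S * S * U * (Cᵀ * Cᵀ) := by
    rw [hstep, hstep]
    simp only [Matrix.mul_add, Matrix.add_mul, Matrix.mul_one, Matrix.one_mul,
      Matrix.mul_assoc]
    abel
  rw [hexpand]
  have h₁ := rank_mul_mul_le (P * P) U (1 : Matrix (Fin N) (Fin N) ℝ)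
  have h₂ := rank_mul_mul_le (P + P) U Q
  have h₃ := rank_mul_mul_le (1 : Matrix (Fin M) (Fin M) ℝ) U (Q * Q)
  have h₄ := rank_mul_mul_le (P * S + S * P) U Cᵀ
  have h₅ := rank_mul_mul_le S U (Q * Cᵀ + Cᵀ * Q)
  have h₆ := rank_mul_mul_le (S * S) U (Cᵀ * Cᵀ)
  refine (rank_add_le_add _ _).trans ?_
  grw [rank_add_le_add, rank_add_le_add, rank_add_le_add, rank_add_le_add]
  omega
end
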